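/- (Variant of Theorem 1.1(1) with hyperplane sections of the singular locus.) Suppose δ ≥ 1 is an integer such that ord_0(f_h) ≤ δ for every h ∈ GL_{N+1}(k), and s′ ≥ −1 is an integer such that for every nonzero linear form ℓ ∈ k[X_0,…,X_N]_1, the Krull dimension of the quotient of k[X_0,…,X_N] by the ideal generated by ℓ, F and the partial derivatives ∂F/∂X_0,…,∂F/∂X_N is at most s′+1 (i.e. dim(H_sing ∩ V) ≤ s′ for every hyperplane V of P^N_k). If d ≥ δ·min(N+1, s′+3), then for every g ∈ GL_{N+1}(k) and every nonzero α ∈ ℤ^{N+1} with Σ_{i=0}^N α_i = 0, one has deg_α(F∘g) ≥ 0; that is, F satisfies the Hilbert–Mumford criterion for semistability, so H is semistable. -/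

import Mathlib

open MvPolynomial

/-- The `α`-degree of a multivariate polynomial `G`: the maximum of `∑ i, m i * α i`
over the monomials `X^m` occurring in `G` with nonzero coefficient (0 if `G = 0`). -/
noncomputable def adeg {k : Type*} [CommSemiring k] {n : ℕ} (α : Fin n → ℤ)
    (G : MvPolynomial (Fin n) k) : ℤ :=
  if h : G.support.Nonempty then G.support.sup' h (fun m => ∑ i, (m i : ℤ) * α i) else 0

/-- `F ∘ g`: the polynomial obtained from `F` by the substitution `X i ↦ ∑ j, g i j • X j`. -/
noncomputable def substGL {k : Type*} [CommRing k] {n : ℕ}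
    (g : Matrix (Fin n) (Fin n) k) (F : MvPolynomial (Fin n) k) :
    MvPolynomial (Fin n) k :=
  aeval (fun i => ∑ j, C (g i j) * X j) F

/-- Dehomogenization with respect to the last variable:
`G(X_0, …, X_N) ↦ G(x_0, …, x_{N-1}, 1)`. -/
noncomputable def dehom {k : Type*} [CommRing k] {N : ℕ}
    (G : MvPolynomial (Fin (N+1)) k) : MvPolynomial (Fin N) k :=
  aeval (fun i : Fin (N+1) => if h : (i : ℕ) < N then X ⟨i, h⟩ else 1) G

/-- `ord_0 f`: the minimal total degree of a monomial occurring in `f`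
with nonzero coefficient (0 if `f = 0`). -/
noncomputable def ord0 {k : Type*} [CommSemiring k] {N : ℕ}
    (f : MvPolynomial (Fin N) k) : ℕ :=
  if h : f.support.Nonempty then f.support.inf' h (fun m => ∑ i, m i) else 0

/-- The ideal generated by `F` and its partial derivatives, defining the singular
locus `H_sing` of the hypersurface `H = {F = 0}`. -/
noncomputable def jacobianIdeal {k : Type*} [CommRing k] {N : ℕ}
    (F : MvPolynomial (Fin (N+1)) k) : Ideal (MvPolynomial (Fin (N+1)) k) :=
  Ideal.span ({F} ∪ Set.range (fun i => pderiv i F))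

theorem substGL_isHomogeneous {k : Type*} [CommRing k] {n d : ℕ}
    (g : Matrix (Fin n) (Fin n) k) {F : MvPolynomial (Fin n) k} (hF : F.IsHomogeneous d) :
    (substGL g F).IsHomogeneous d := by
  have h := hF.aeval (S := k) (fun i => ∑ j, C (g i j) * X j) (n := 1) (fun i =>
    IsHomogeneous.sum _ _ _ fun j _ => (isHomogeneous_X k j).C_mul (g i j))
  simpa [substGL] using h

theorem substGL_substGL {k : Type*} [CommRing k] {n : ℕ}
    (g h : Matrix (Fin n) (Fin n) k) (F : MvPolynomial (Fin n) k) :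
    substGL h (substGL g F) = substGL (g * h) F := by
  unfold substGL
  rw [← AlgHom.comp_apply]
  congr 1
  ext1 i
  simp only [AlgHom.comp_apply, aeval_X, map_sum, map_mul, algHom_C, algebraMap_eq,
    Matrix.mul_apply, Finset.sum_mul, Finset.mul_sum]
  rw [Finset.sum_comm]
  simp only [mul_assoc]

theorem substGL_one {k : Type*} [CommRing k] {n : ℕ} (F : MvPolynomial (Fin n) k) :
    substGL 1 F = F := by
  simp [substGL, Matrix.one_apply]

theorem substGL_permMatrix {k : Type*} [CommRing k] {n : ℕ} (σ : Equiv.Perm (Fin n))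
    (F : MvPolynomial (Fin n) k) :
    substGL (σ.permMatrix k) F = rename σ F := by
  unfold substGL
  congr 1
  ext1 i
  simp [Equiv.Perm.permMatrix, PEquiv.toMatrix_apply, rename_X]

/-- The chain rule for linear substitutions. -/
theorem pderiv_substGL {k : Type*} [CommRing k] {n : ℕ}
    (g : Matrix (Fin n) (Fin n) k) (j : Fin n) (F : MvPolynomial (Fin n) k) :
    pderiv j (substGL g F) = ∑ i, C (g i j) * substGL g (pderiv i F) := by
  induction F using MvPolynomial.induction_on with
  | C a => simp [substGL]
  | add p q hp hq =>
    simp only [substGL, map_add, mul_add, Finset.sum_add_distrib] at hp hq ⊢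
    rw [hp, hq]
  | mul_X p l hp =>
    simp only [substGL, map_mul, pderiv_mul, map_add, aeval_X, mul_add,
      Finset.sum_add_distrib] at hp ⊢
    rw [hp]
    congr 1
    · rw [Finset.sum_mul]
      exact Finset.sum_congr rfl fun i _ => by ring
    · symm
      rw [Finset.sum_eq_single l]
      · simp [pderiv_X, Pi.single_apply, mul_comm]
      · intro b _ hb
        rw [pderiv_X_of_ne hb.symm, map_zero, mul_zero, mul_zero]
      · simp

theorem substGL_pderiv {k : Type*} [CommRing k] {n : ℕ}
    (g g' : Matrix (Fin n) (Fin n) k) (hg : g * g' = 1) (i : Fin n)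
    (F : MvPolynomial (Fin n) k) :
    substGL g (pderiv i F) = ∑ j, C (g' j i) * pderiv j (substGL g F) := by
  have h (l : Fin n) : ∑ j, C (g' j i) * (C (g l j) * substGL g (pderiv l F)) =
      C ((1 : Matrix (Fin n) (Fin n) k) l i) * substGL g (pderiv l F) := by
    rw [← hg, Matrix.mul_apply, map_sum, Finset.sum_mul]
    exact Finset.sum_congr rfl fun j _ => by rw [C_mul]; ring
  simp_rw [pderiv_substGL, Finset.mul_sum]
  rw [Finset.sum_comm]
  simp [h, Matrix.one_apply]

theorem le_height_ker_constantCoeff {k : Type*} [Field k] (n : ℕ) :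
    (n : ℕ∞) ≤ (RingHom.ker (constantCoeff : MvPolynomial (Fin n) k →+* k)).height := by
  let f (i : ℕ) : MvPolynomial (Fin n) k →ₐ[k] MvPolynomial (Fin n) k :=
    aeval fun j => if (j : ℕ) < i then 0 else X j
  have hprime (i : ℕ) : (RingHom.ker (f i)).IsPrime := RingHom.ker_isPrime _
  have key : ∀ i ≤ n, (i : ℕ∞) ≤ (RingHom.ker (f i)).height := by
    intro i
    induction i with
    | zero => simp
    | succ i ih =>
      intro hi
      have hcomp : (f (i + 1)).comp (f i) = f (i + 1) := by
        ext1 j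
        by_cases hj : (j : ℕ) < i
        · simp [f, hj, hj.le]
        · simp [f, hj]
      have hlt : RingHom.ker (f i) < RingHom.ker (f (i + 1)) := by
        refine SetLike.lt_iff_le_and_exists.mpr ⟨fun p hp => ?_, X ⟨i, hi⟩, ?_, ?_⟩
        · rw [RingHom.mem_ker] at hp ⊢
          rw [← hcomp, AlgHom.comp_apply, hp, map_zero]
        · simp [f, RingHom.mem_ker]
        · simp [f, RingHom.mem_ker]
      push_cast
      exact (add_le_add_left (ih (by omega)) 1).trans
        (Order.add_one_le_of_lt (Ideal.height_strict_mono_of_isPrime_of_isPrime hlt))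
  refine (key n le_rfl).trans (Ideal.height_mono fun p hp => ?_)
  have h0 : (fun j : Fin n => if (j : ℕ) < n then (0 : MvPolynomial (Fin n) k) else X j) =
      fun _ => 0 := by
    ext1 j; simp
  rw [RingHom.mem_ker] at hp ⊢
  have hp' : aeval (fun _ => (0 : MvPolynomial (Fin n) k)) p = 0 := h0 ▸ hp
  rw [aeval_zero'] at hp'
  exact C_injective (Fin n) k (by simpa [algebraMap_eq] using hp')

theorem le_add_of_le_height_of_ringKrullDim_le {R S : Type*} [CommRing R] [CommRing S]
    [IsNoetherianRing S] (φ : R →+* S) (hφ : Function.Surjective φ) {J : Ideal R}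
    {K P : Ideal S} [P.IsPrime] (hJK : J ≤ K.comap φ) (hKP : K ≤ P) {n c r : ℕ}
    (hn : (n : ℕ∞) ≤ P.height) (hc : ringKrullDim (R ⧸ J) ≤ (c : WithBot ℕ∞))
    (hr : K.spanFinrank ≤ r) : n ≤ c + r := by
  have hKdim := (ringKrullDim_le_of_surjective (Ideal.quotientMap K φ hJK)
    (Ideal.quotientMap_surjective hφ)).trans hc
  have h : ((n : ℕ∞) : WithBot ℕ∞) ≤ (c : WithBot ℕ∞) + ((r : ℕ) : WithBot ℕ∞) :=
    (WithBot.coe_le_coe.mpr hn).trans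
      ((height_le_ringKrullDim_quotient_add_spanFinrank hKP).trans
        (add_le_add hKdim (by exact_mod_cast hr)))
  exact_mod_cast h

/-- If every monomial of `G` involves a variable outside `S`, and the monomials linear in the
variables outside `S` involve such a variable in `T`, then `G` and its partial derivatives lie in
the ideal generated by the variables outside `S` and the derivatives with respect to `T`. -/
theorem mem_span_X_union_pderiv {k : Type*} [CommRing k] {n : ℕ} {G : MvPolynomial (Fin n) k}
    {S T : Finset (Fin n)} (hS : ∀ m ∈ G.support, ∃ j ∉ S, m j ≠ 0)
    (hT : ∀ m ∈ G.support, ∀ i ∉ S, i ∉ T → m i = 1 → ∃ j ∉ S, j ≠ i ∧ m j ≠ 0) :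
    G ∈ Ideal.span (X '' (↑(Sᶜ) : Set (Fin n)) ∪ (fun i => pderiv i G) '' (T : Set (Fin n))) ∧
    ∀ i, pderiv i G ∈
      Ideal.span (X '' (↑(Sᶜ) : Set (Fin n)) ∪ (fun i => pderiv i G) '' (T : Set (Fin n))) := by
  have hA : Ideal.span (X '' (↑(Sᶜ) : Set (Fin n))) ≤
      Ideal.span (X '' (↑(Sᶜ) : Set (Fin n)) ∪ (fun i => pderiv i G) '' (T : Set (Fin n))) :=
    Ideal.span_mono Set.subset_union_left
  refine ⟨hA <| mem_ideal_span_X_image.mpr fun m hm => ?_, fun i => ?_⟩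
  · obtain ⟨j, hj, hj0⟩ := hS m hm
    exact ⟨j, by simpa using hj, hj0⟩
  · by_cases hi : i ∈ T
    · exact Ideal.subset_span (Or.inr ⟨i, hi, rfl⟩)
    refine hA <| mem_ideal_span_X_image.mpr fun m hm => ?_
    have hm' : m + Finsupp.single i 1 ∈ G.support := by
      rw [mem_support_iff, coeff_pderiv] at hm
      exact mem_support_iff.mpr (left_ne_zero_of_mul hm)
    by_cases hiS : i ∈ S
    · obtain ⟨j, hj, hj0⟩ := hS _ hm'
      have hne : i ≠ j := fun h => hj (h ▸ hiS)
      exact ⟨j, by simpa using hj, by simpa [Finsupp.single_apply, hne] using hj0⟩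
    · by_cases hmi : m i = 0
      · obtain ⟨j, hj, hji, hj0⟩ := hT _ hm' i hiS hi (by simp [hmi])
        exact ⟨j, by simpa using hj, by simpa [Finsupp.single_apply, hji.symm] using hj0⟩
      · exact ⟨i, by simpa using hiS, hmi⟩

theorem spanFinrank_span_X_union_pderiv_le {k : Type*} [CommRing k] {n : ℕ}
    (G : MvPolynomial (Fin n) k) (S T : Finset (Fin n)) :
    (Ideal.span (X '' (↑(Sᶜ) : Set (Fin n)) ∪
      (fun i => pderiv i G) '' (T : Set (Fin n)))).spanFinrank ≤ Sᶜ.card + T.card := by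
  refine (Submodule.spanFinrank_span_le_ncard_of_finite
    (((Finset.finite_toSet _).image _).union ((Finset.finite_toSet _).image _))).trans
    ((Set.ncard_union_le _ _).trans (add_le_add ?_ ?_))
  · exact (Set.ncard_image_le (Finset.finite_toSet _)).trans (Set.ncard_coe_finset _).le
  · exact (Set.ncard_image_le (Finset.finite_toSet _)).trans (Set.ncard_coe_finset _).le

theorem span_X_union_pderiv_le_ker_constantCoeff {k : Type*} [CommRing k] {n d : ℕ} (hd : 2 ≤ d)
    {G : MvPolynomial (Fin n) k} (hG : G.IsHomogeneous d) (S T : Set (Fin n)) :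
    Ideal.span (X '' S ∪ (fun i => pderiv i G) '' T) ≤
      RingHom.ker (constantCoeff : MvPolynomial (Fin n) k →+* k) := by
  rw [Ideal.span_le]
  rintro p (⟨j, -, rfl⟩ | ⟨j, -, rfl⟩)
  · rw [SetLike.mem_coe, RingHom.mem_ker, constantCoeff_X]
  · rw [SetLike.mem_coe, RingHom.mem_ker, constantCoeff_eq]
    refine (hG.pderiv (i := j)).coeff_eq_zero ?_
    rw [map_zero]
    omega

/-- A linear section of the singular locus cut out by the coordinates outside `S` has large
dimension if few partial derivatives are nonzero on it. -/
theorem le_add_of_ringKrullDim_singular_section_le {k : Type*} [Field k] {n d : ℕ} (hd : 2 ≤ d)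
    (F : MvPolynomial (Fin n) k) (hF : F.IsHomogeneous d)
    (g : Matrix.GeneralLinearGroup (Fin n) k) (c : ℕ)
    (hsing : ∀ ℓ : MvPolynomial (Fin n) k, ℓ ≠ 0 → ℓ.IsHomogeneous 1 →
      ringKrullDim (MvPolynomial (Fin n) k ⧸
          Ideal.span ({ℓ, F} ∪ Set.range (fun i => pderiv i F))) ≤ (c : WithBot ℕ∞))
    (S T : Finset (Fin n)) (a : Fin n) (ha : a ∉ S)
    (hS : ∀ m ∈ (substGL g.val F).support, ∃ j ∉ S, m j ≠ 0)
    (hT : ∀ m ∈ (substGL g.val F).support, ∀ i ∉ S, i ∉ T → m i = 1 →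
      ∃ j ∉ S, j ≠ i ∧ m j ≠ 0) :
    n ≤ c + (Sᶜ.card + T.card) := by
  obtain ⟨hGK, hdK⟩ := mem_span_X_union_pderiv hS hT
  have hrank := spanFinrank_span_X_union_pderiv_le (substGL g.val F) S T
  have hKle := span_X_union_pderiv_le_ker_constantCoeff hd (substGL_isHomogeneous g.val hF)
    (↑(Sᶜ) : Set (Fin n)) T
  have haK : X a ∈ Ideal.span (X '' (↑(Sᶜ) : Set (Fin n)) ∪
      (fun i => pderiv i (substGL g.val F)) '' (T : Set (Fin n))) :=
    Ideal.subset_span (Or.inl ⟨a, by simpa using ha, rfl⟩)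
  generalize Ideal.span (X '' (↑(Sᶜ) : Set (Fin n)) ∪
    (fun i => pderiv i (substGL g.val F)) '' (T : Set (Fin n))) = K at *
  obtain ⟨φ, hφ⟩ : ∃ φ : MvPolynomial (Fin n) k →+* MvPolynomial (Fin n) k,
      ∀ p, φ p = substGL g.val p := ⟨(aeval _).toRingHom, fun _ => rfl⟩
  have hinv (p : MvPolynomial (Fin n) k) : φ (substGL (g⁻¹).val p) = p := by
    rw [hφ, substGL_substGL, ← Units.val_mul, inv_mul_cancel, Units.val_one, substGL_one]
  have hℓ0 : substGL (g⁻¹).val (X a) ≠ 0 := fun h => X_ne_zero (R := k) a (by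
    rw [← hinv (X a), ← map_zero φ, ← h])
  have hdim := hsing _ hℓ0 (substGL_isHomogeneous _ (isHomogeneous_X k a))
  have hJK : Ideal.span ({substGL (g⁻¹).val (X a), F} ∪ Set.range (fun i => pderiv i F)) ≤
      K.comap φ := by
    rw [Ideal.span_le]
    rintro p ((rfl | rfl) | ⟨i, rfl⟩)
    · rwa [SetLike.mem_coe, Ideal.mem_comap, hinv]
    · rwa [SetLike.mem_coe, Ideal.mem_comap, hφ]
    · rw [SetLike.mem_coe, Ideal.mem_comap, hφ, substGL_pderiv g.val (g⁻¹).val (g.mul_inv)]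
      exact K.sum_mem fun j _ => K.mul_mem_left _ (hdK j)
  have hprime : (RingHom.ker (constantCoeff : MvPolynomial (Fin n) k →+* k)).IsPrime :=
    RingHom.ker_isPrime _
  exact le_add_of_le_height_of_ringKrullDim_le φ (fun p => ⟨_, hinv p⟩) hJK hKle
    (le_height_ker_constantCoeff n) hdim hrank

theorem dehom_eq_sum {k : Type*} [CommRing k] {N : ℕ} (G : MvPolynomial (Fin (N+1)) k) :
    dehom G = ∑ m ∈ G.support,
      monomial (Finsupp.equivFunOnFinite.symm fun i : Fin N => m i.castSucc) (coeff m G) := by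
  conv_lhs => rw [G.as_sum]
  unfold dehom
  rw [map_sum]
  refine Finset.sum_congr rfl fun m _ => ?_
  rw [aeval_monomial, monomial_eq, Finsupp.prod_fintype _ _ (by simp),
    Finsupp.prod_fintype _ _ (by simp), Fin.prod_univ_castSucc]
  simp [algebraMap_eq]

/-- A homogeneous polynomial whose dehomogenization has order at most `δ` contains a monomial
in which the last variable has exponent at least `d - δ`. -/
theorem exists_mem_support_of_ord0_dehom_le {k : Type*} [CommRing k] {N d δ : ℕ}
    {G : MvPolynomial (Fin (N+1)) k} (hG : G.IsHomogeneous d) (hG0 : G ≠ 0)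
    (h : ord0 (dehom G) ≤ δ) : ∃ m ∈ G.support, d ≤ m (Fin.last N) + δ := by
  classical
  let res (m : Fin (N+1) →₀ ℕ) : Fin N →₀ ℕ :=
    Finsupp.equivFunOnFinite.symm fun i : Fin N => m i.castSucc
  have hres (m) (i : Fin N) : res m i = m i.castSucc := rfl
  have hcoeff (u) : coeff u (dehom G) =
      ∑ m ∈ G.support, if res m = u then coeff m G else 0 := by
    rw [dehom_eq_sum, coeff_sum]
    simp only [coeff_monomial]
    rfl
  have hsum (m) (hm : m ∈ G.support) : ∑ i, res m i + m (Fin.last N) = d := by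
    rw [hG.degree_eq_sum_deg_support hm, ← Finsupp.degree_apply, Finsupp.degree_eq_sum, Fin.sum_univ_castSucc]
    rfl
  have hne : (dehom G).support.Nonempty := by
    obtain ⟨m, hm⟩ := support_nonempty.mpr hG0
    refine ⟨res m, ?_⟩
    rw [mem_support_iff, hcoeff, Finset.sum_eq_single m]
    · simpa using hm
    · intro m' hm' hne
      refine if_neg fun heq => hne ?_
      ext i
      refine Fin.lastCases ?_ (fun i => ?_) i
      · have h1 := hsum m hm
        have h2 := hsum m' hm'
        rw [heq] at h2
        omega
      · rw [← hres, heq, hres]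
    · exact fun hm' => absurd hm hm'
  rw [ord0, dif_pos hne] at h
  obtain ⟨u, hu, hu'⟩ := Finset.exists_mem_eq_inf' hne fun m => ∑ i, m i
  rw [hu'] at h
  rw [mem_support_iff, hcoeff] at hu
  obtain ⟨m, hm, hmu⟩ := Finset.exists_ne_zero_of_sum_ne_zero hu
  have hmu' : res m = u := by
    by_contra hcon
    exact hmu (if_neg hcon)
  refine ⟨m, hm, ?_⟩
  have := hsum m hm
  rw [hmu'] at this
  omega

theorem exists_mem_support_of_forall_ord0_le {k : Type*} [CommRing k] {N d δ : ℕ}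
    {F : MvPolynomial (Fin (N+1)) k} (hF : F.IsHomogeneous d) (hF0 : F ≠ 0)
    (hmult : ∀ h : Matrix.GeneralLinearGroup (Fin (N+1)) k,
      ord0 (dehom (substGL (↑h) F)) ≤ δ)
    (g : Matrix.GeneralLinearGroup (Fin (N+1)) k) (a : Fin (N+1)) :
    ∃ m ∈ (substGL (↑g) F).support, d ≤ m a + δ := by
  classical
  set σ : Equiv.Perm (Fin (N+1)) := Equiv.swap a (Fin.last N) with hσ
  have hσσ : σ.permMatrix k * σ.permMatrix k = 1 := by
    rw [← Matrix.permMatrix_mul, hσ, Equiv.swap_mul_self, Matrix.permMatrix_one]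
  let P : Matrix.GeneralLinearGroup (Fin (N+1)) k := ⟨σ.permMatrix k, σ.permMatrix k, hσσ, hσσ⟩
  have hsub : substGL (↑(g * P)) F = rename σ (substGL (↑g) F) := by
    rw [← substGL_permMatrix, substGL_substGL]
    rfl
  have hne : substGL (↑(g * P)) F ≠ 0 := by
    intro h
    have h' := congrArg (substGL ((g * P)⁻¹).val) h
    rw [substGL_substGL, ← Units.val_mul, mul_inv_cancel, Units.val_one, substGL_one] at h'
    exact hF0 (by simpa [substGL] using h')
  obtain ⟨m, hm, hmd⟩ := exists_mem_support_of_ord0_dehom_le (substGL_isHomogeneous _ hF) hne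
    (hmult (g * P))
  rw [hsub, support_rename_of_injective σ.injective, Finset.mem_image] at hm
  obtain ⟨m', hm', rfl⟩ := hm
  refine ⟨m', hm', ?_⟩
  have : Fin.last N = σ a := by simp [hσ]
  rwa [this, Finsupp.mapDomain_apply σ.injective] at hmd

/-- The numerical heart of the argument: the extreme entries are controlled by the multiplicity
bound, and the middle entries are paired off by a reflection. -/
theorem nonneg_of_antitone_of_sum_eq_zero {N d δ t : ℕ} {b : ℕ → ℤ}
    (hb : ∀ i j, i ≤ j → j ≤ N → b j ≤ b i) (hsum : ∑ i ∈ Finset.range (N + 1), b i = 0)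
    (hdeg : (δ : ℤ) * min ((N : ℤ) + 1) (t + 1) ≤ d)
    (hpair : ∀ r p, t ≤ r → r ≤ p → p < N → r + p + 1 = N + t → b r + b p ≤ 0) :
    0 ≤ ((d : ℤ) - δ) * b 0 + δ * b N := by
  obtain ⟨u, q, hN, hu, hq⟩ : ∃ u q : ℕ, N = u + q ∧ min ((N : ℤ) + 1) (t + 1) = u + 1 ∧
      (q ≠ 0 → u = t) := by
    rcases le_total N t with h | h
    · exact ⟨N, 0, rfl, by omega, by simp⟩
    · exact ⟨t, N - t, by omega, by omega, by simp⟩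
  have hb0 : 0 ≤ b 0 := by
    by_contra! hneg
    have : ∑ i ∈ Finset.range (N + 1), b i < 0 :=
      Finset.sum_neg (fun i hi => (hb 0 i (Nat.zero_le _)
        (by have := Finset.mem_range.mp hi; omega)).trans_lt hneg) (by simp)
    omega
  have hhead : ∑ i ∈ Finset.range u, b i ≤ u * b 0 := by
    refine (Finset.sum_le_card_nsmul _ _ (b 0) fun i hi => ?_).trans (by simp)
    have := Finset.mem_range.mp hi
    exact hb 0 i (Nat.zero_le _) (by omega)
  have hmid : ∑ i ∈ Finset.range q, b (u + i) ≤ 0 := by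
    have hrefl := Finset.sum_range_reflect (fun i => b (u + i)) q
    have hle : ∑ i ∈ Finset.range q, (b (u + i) + b (u + (q - 1 - i))) ≤ 0 := by
      refine Finset.sum_nonpos fun i hi => ?_
      have hi' := Finset.mem_range.mp hi
      have hut := hq (by omega)
      rcases le_total (u + i) (u + (q - 1 - i)) with h | h
      · exact hpair _ _ (by omega) h (by omega) (by omega)
      · rw [add_comm]
        exact hpair _ _ (by omega) h (by omega) (by omega)
    rw [Finset.sum_add_distrib] at hle
    omega
  rw [Finset.sum_range_succ, hN, Finset.sum_range_add, ← hN] at hsum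
  rw [hu] at hdeg
  have h1 : 0 ≤ (u : ℤ) * b 0 + b N := by omega
  nlinarith [mul_nonneg (Int.natCast_nonneg δ) h1, mul_le_mul_of_nonneg_right hdeg hb0]

theorem card_filter_lt_perm_symm_le {N : ℕ} (σ : Equiv.Perm (Fin (N + 1))) (r : ℕ) :
    (Finset.univ.filter fun j => r < (σ.symm j : ℕ)).card ≤ N - r := by
  rw [← Nat.card_Ioc]
  refine Finset.card_le_card_of_injOn (fun j => (σ.symm j : ℕ)) (fun j hj => ?_)
    (fun i _ j _ h => σ.symm.injective (Fin.ext h))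
  have := (σ.symm j).is_lt
  simp only [Finset.coe_filter, Finset.mem_univ, true_and, Set.mem_ofPred_eq] at hj
  simp only [Finset.coe_Ioc, Set.mem_Ioc]
  omega

theorem sum_mul_lt_zero_of_adeg_lt_zero {k : Type*} [CommSemiring k] {n : ℕ} {α : Fin n → ℤ}
    {G : MvPolynomial (Fin n) k} (h : adeg α G < 0) {m : Fin n →₀ ℕ} (hm : m ∈ G.support) :
    ∑ i, (m i : ℤ) * α i < 0 := by
  have hne : G.support.Nonempty := ⟨m, hm⟩
  rw [adeg, dif_pos hne] at h
  exact (Finset.le_sup' (fun m : Fin n →₀ ℕ => ∑ i, (m i : ℤ) * α i) hm).trans_lt h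

theorem add_mul_le_sum_mul {ι : Type*} [Fintype ι] [DecidableEq ι] {d : ℤ} {m : ι → ℕ}
    {α : ι → ℤ} (hm : ∑ i, (m i : ℤ) = d) (a : ι) (x y : ℤ)
    (h : ∀ j, (m j : ℤ) * x + (if j = a then y else 0) ≤ m j * α j) :
    d * x + y ≤ ∑ i, (m i : ℤ) * α i := by
  calc d * x + y = ∑ j, ((m j : ℤ) * x + if j = a then y else 0) := by
        rw [Finset.sum_add_distrib, ← Finset.sum_mul, hm]
        simp
    _ ≤ _ := Finset.sum_le_sum fun j _ => h j

/-- Variant of the main theorem with hyperplane sections of the singular locus: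
if the multiplicity of `H = {F = 0}` at every point is at most `δ`,
`dim (H_sing ∩ V) ≤ s'` for every hyperplane `V = {ℓ = 0}` of `P^N_k`, and
`d ≥ δ · min(N+1, s'+3)`, then `F` satisfies the Hilbert–Mumford criterion for
semistability, i.e. `H` is semistable. -/
theorem semistable_of_deg_ge_hyperplane_sections {k : Type*} [Field k] [IsAlgClosed k]
    {N d : ℕ} (hN : 1 ≤ N) (hd : 2 ≤ d)
    (F : MvPolynomial (Fin (N+1)) k) (hF0 : F ≠ 0) (hFhom : F.IsHomogeneous d)
    (δ : ℕ) (hδ : 1 ≤ δ)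
    (hmult : ∀ h : Matrix.GeneralLinearGroup (Fin (N+1)) k,
      ord0 (dehom (substGL (↑h) F)) ≤ δ)
    (s' : ℤ) (hs' : -1 ≤ s')
    (hsing : ∀ ℓ : MvPolynomial (Fin (N+1)) k, ℓ ≠ 0 → ℓ.IsHomogeneous 1 →
      ringKrullDim (MvPolynomial (Fin (N+1)) k ⧸
          Ideal.span ({ℓ, F} ∪ Set.range (fun i => pderiv i F)))
        ≤ ((s'+1).toNat : WithBot ℕ∞))
    (hdeg : (δ : ℤ) * min ((N : ℤ) + 1) (s' + 3) ≤ (d : ℤ)) :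
    ∀ g : Matrix.GeneralLinearGroup (Fin (N+1)) k, ∀ α : Fin (N+1) → ℤ,
      α ≠ 0 → (∑ i, α i) = 0 → 0 ≤ adeg α (substGL (↑g) F) := by
  intro g α _ hα
  by_contra! hneg
  set G := substGL g.val F with hG
  have hGhom : G.IsHomogeneous d := substGL_isHomogeneous _ hFhom
  have hlt {m} (hm : m ∈ G.support) := sum_mul_lt_zero_of_adeg_lt_zero hneg hm
  have hmsum {m} (hm : m ∈ G.support) : ∑ i, (m i : ℤ) = d := by
    rw [hGhom.degree_eq_sum_deg_support hm, ← Finsupp.degree_apply, Finsupp.degree_eq_sum]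
    push_cast
    rfl
  set σ := Tuple.sort fun i => -α i
  have hσ : Antitone (α ∘ σ) := fun i j hij =>
    neg_le_neg_iff.mp (Tuple.monotone_sort (fun i => -α i) hij)
  have hσ' (i j : Fin (N + 1)) (h : σ.symm i ≤ σ.symm j) : α j ≤ α i := by
    simpa using hσ h
  set b : ℕ → ℤ := fun i => α (σ (Fin.ofNat (N + 1) i)) with hbdef
  have hval {i : ℕ} (hi : i ≤ N) : (Fin.ofNat (N + 1) i : ℕ) = i :=
    Nat.mod_eq_of_lt (Nat.lt_succ_of_le hi)
  have hb (i j : ℕ) (hij : i ≤ j) (hj : j ≤ N) : b j ≤ b i :=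
    hσ (Fin.le_def.mpr (by rwa [hval hj, hval (hij.trans hj)]))
  have hble (i : ℕ) (hi : i ≤ N) (j : Fin (N + 1)) (h : (σ.symm j : ℕ) ≤ i) : b i ≤ α j :=
    hσ' _ _ (Fin.le_def.mpr (by rwa [Equiv.symm_apply_apply, hval hi]))
  have hbsum : ∑ i ∈ Finset.range (N + 1), b i = 0 := by
    rw [Finset.sum_range, ← hα, ← Equiv.sum_comp σ α]
    simp [hbdef]
  obtain ⟨t, ht⟩ : ∃ t : ℕ, s' + 1 = t := ⟨(s' + 1).toNat, by omega⟩
  rw [ht, Int.toNat_natCast] at hsing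
  have hdeg' : (δ : ℤ) * min ((N : ℤ) + 1) ((t + 1 : ℕ) + 1) ≤ d := by
    convert hdeg using 3
    push_cast
    omega
  refine absurd (nonneg_of_antitone_of_sum_eq_zero hb hbsum hdeg' ?_) (not_le.mpr ?_)
  · intro r p htr hrp hpN hrpt
    by_contra! hpos
    have hr0 : 0 ≤ b r := by
      have := hb r p hrp hpN.le
      omega
    have hp0 : 0 ≤ d * b r + (b p - b r) := by
      nlinarith [mul_le_mul_of_nonneg_right (show (2 : ℤ) ≤ d by exact_mod_cast hd) hr0]
    have hcard := le_add_of_ringKrullDim_singular_section_le hd F hFhom g t hsing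
      (Finset.univ.filter fun j => ¬ r < (σ.symm j : ℕ))
      (Finset.univ.filter fun j => p < (σ.symm j : ℕ)) (σ (Fin.last N))
      (by simp; omega) ?_ ?_
    · rw [Finset.compl_filter] at hcard
      simp only [not_not] at hcard
      have h1 := card_filter_lt_perm_symm_le σ r
      have h2 := card_filter_lt_perm_symm_le σ p
      omega
    · intro m hm
      by_contra! hcon
      refine absurd (hlt hm) (not_lt.mpr ?_)
      refine Finset.sum_nonneg fun j _ => ?_
      by_cases hj : r < (σ.symm j : ℕ)
      · simp [hcon j (by simpa using hj)]
      · exact mul_nonneg (Int.natCast_nonneg _)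
          (hr0.trans (hble r (by omega) j (not_lt.mp hj)))
    · intro m hm i hiS hiT hmi
      by_contra! hcon
      refine absurd (hlt hm) (not_lt.mpr
        (hp0.trans (add_mul_le_sum_mul (hmsum hm) i _ _ fun j => ?_)))
      split_ifs with hji
      · subst hji
        have := hble p hpN.le j (by simpa using hiT)
        rw [hmi]
        push_cast
        omega
      · rw [add_zero]
        by_cases hj : r < (σ.symm j : ℕ)
        · simp [hcon j (by simpa using hj) hji]
        · exact mul_le_mul_of_nonneg_left (hble r (by omega) j (not_lt.mp hj))
            (Int.natCast_nonneg _)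
  · obtain ⟨m, hm, hmd⟩ := exists_mem_support_of_forall_ord0_le hFhom hF0 hmult g
      (σ (Fin.ofNat (N + 1) 0))
    have h := add_mul_le_sum_mul (α := α) (hmsum hm) (σ (Fin.ofNat (N + 1) 0)) (b N)
      (m (σ (Fin.ofNat (N + 1) 0)) * (b 0 - b N)) fun j => by
        split_ifs with hj
        · subst hj
          exact le_of_eq (by ring)
        · rw [add_zero]
          exact mul_le_mul_of_nonneg_left (hble N le_rfl j (Nat.lt_succ_iff.mp (Fin.is_lt _)))
            (Int.natCast_nonneg _)
    have hmd' : (d : ℤ) - δ ≤ m (σ (Fin.ofNat (N + 1) 0)) := by omega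
    nlinarith [hlt hm, mul_le_mul_of_nonneg_right hmd'
      (sub_nonneg.mpr (hb 0 N (Nat.zero_le _) le_rfl))]
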